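/- arXiv:0801.0777 — 3 statements merged into one kernel-verified Lean document; each statement's English description precedes it below -/
import Mathlib

section
/- Let (Ω, Σ, μ) be a probability space, let X be a Banach space, and let a_n : X → L⁰(Ω, μ) be a sequence of linear maps, each continuous from the norm topology of X to convergence in measure. Assume that for every x ∈ X, sup_n |a_n(x)(ω)| < ∞ for almost every ω. Then the maximal operator â(x) = sup_n |a_n(x)| is continuous at 0: whenever x_k → 0 in the norm of X, the sequence â(x_k) converges to 0 in measure. -/
open MeasureTheory Filter Topology
open scoped ENNReal

/-- If each `a n` is sequentially continuous into convergence in measure, the set of `x` whose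
maximal function exceeds `C` on a set of measure at most `ε` is closed. -/
theorem isClosed_setOf_measure_exists_lt_norm_le
    {Ω : Type*} [MeasurableSpace Ω] (μ : Measure Ω) {X E : Type*}
    [TopologicalSpace X] [SequentialSpace X] [SeminormedAddCommGroup E] (a : ℕ → X → Ω → E)
    (hcont : ∀ n (x : X) (u : ℕ → X), Tendsto u atTop (𝓝 x) →
      TendstoInMeasure μ (fun k => a n (u k)) atTop (a n x))
    (C : ℝ) (ε : ℝ≥0∞) :
    IsClosed {x | μ {ω | ∃ n, C < ‖a n x ω‖} ≤ ε} := by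
  refine IsSeqClosed.isClosed fun u x hu hux => ?_
  simp only [Set.mem_ofPred_eq] at hu ⊢
  let A : ℕ → Set Ω := fun j => {ω | ∃ n ≤ j, C + 1 / ((j : ℝ) + 1) < ‖a n x ω‖}
  have hA : Monotone A := by
    rintro i j hij ω ⟨n, hn, h⟩
    exact ⟨n, hn.trans hij, lt_of_le_of_lt (by gcongr) h⟩
  have hsub : {ω | ∃ n, C < ‖a n x ω‖} ⊆ ⋃ j, A j := by
    rintro ω ⟨n, hn⟩
    obtain ⟨m, hm⟩ := exists_nat_one_div_lt (sub_pos.2 hn)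
    refine Set.mem_iUnion.2 ⟨max n m, n, le_max_left _ _, ?_⟩
    have : 1 / (((max n m : ℕ) : ℝ) + 1) ≤ 1 / ((m : ℝ) + 1) := by
      gcongr
      exact le_max_right _ _
    linarith
  refine (measure_mono hsub).trans ?_
  rw [hA.measure_iUnion]
  refine iSup_le fun j => ?_
  have hlim : Tendsto (fun k => ε + ∑ n ∈ Finset.range (j + 1),
      μ {ω | 1 / ((j : ℝ) + 1) ≤ ‖a n (u k) ω - a n x ω‖}) atTop (𝓝 (ε + 0)) := by
    refine tendsto_const_nhds.add ?_
    rw [← Finset.sum_const_zero (s := Finset.range (j + 1))]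
    exact tendsto_finsetSum _ fun n _ =>
      tendstoInMeasure_iff_norm.1 (hcont n x u hux) _ (by positivity)
  rw [add_zero] at hlim
  refine ge_of_tendsto' hlim fun k => ?_
  calc μ (A j) ≤ μ ({ω | ∃ n, C < ‖a n (u k) ω‖} ∪ ⋃ n ∈ Finset.range (j + 1),
        {ω | 1 / ((j : ℝ) + 1) ≤ ‖a n (u k) ω - a n x ω‖}) := by
        refine measure_mono ?_
        rintro ω ⟨n, hn, h⟩
        by_cases hC : C < ‖a n (u k) ω‖
        · exact Or.inl ⟨n, hC⟩
        · refine Or.inr (Set.mem_biUnion (Finset.mem_coe.2 (Finset.mem_range.2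
            (Nat.lt_succ_of_le hn))) ?_)
          have := norm_sub_norm_le (a n x ω) (a n (u k) ω)
          rw [norm_sub_rev] at this
          simp only [Set.mem_ofPred_eq]
          linarith
    _ ≤ _ := (measure_union_le _ _).trans
        (add_le_add (hu k) (measure_biUnion_finset_le _ _))

/-- If the sequence `f` is almost everywhere bounded, then its maximal function exceeds a large
constant only on a set of small measure. -/
theorem exists_nat_measure_exists_lt_norm_le
    {Ω : Type*} [MeasurableSpace Ω] (μ : Measure Ω) [IsFiniteMeasure μ] (f : ℕ → Ω → ℂ)
    (hf : ∀ n, Measurable (f n)) (hsup : ∀ᵐ ω ∂μ, (⨆ n, (‖f n ω‖₊ : ℝ≥0∞)) < ⊤)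
    {ε : ℝ≥0∞} (hε : 0 < ε) :
    ∃ N : ℕ, μ {ω | ∃ n, (N : ℝ) < ‖f n ω‖} ≤ ε := by
  have hanti : Antitone fun N : ℕ => {ω | ∃ n, (N : ℝ) < ‖f n ω‖} := by
    rintro i j hij ω ⟨n, hn⟩
    exact ⟨n, lt_of_le_of_lt (by exact_mod_cast hij) hn⟩
  have hm (N : ℕ) : NullMeasurableSet {ω | ∃ n, (N : ℝ) < ‖f n ω‖} μ := by
    rw [Set.ofPred_exists]
    exact (MeasurableSet.iUnion fun n =>
      measurableSet_lt measurable_const (hf n).norm).nullMeasurableSet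
  have hzero : μ (⋂ N : ℕ, {ω | ∃ n, (N : ℝ) < ‖f n ω‖}) = 0 := by
    refine measure_mono_null ?_ (ae_iff.1 hsup)
    intro ω hω hlt
    obtain ⟨N, hN⟩ := ENNReal.exists_nat_gt hlt.ne
    obtain ⟨n, hn⟩ := Set.mem_iInter.1 hω N
    have h1 : (‖f n ω‖₊ : ℝ≥0∞) < N :=
      (le_iSup (fun n => (‖f n ω‖₊ : ℝ≥0∞)) n).trans_lt hN
    have h2 : ‖f n ω‖₊ < (N : NNReal) := by exact_mod_cast h1
    have h3 : ‖f n ω‖ < N := by exact_mod_cast h2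
    exact lt_asymm h3 hn
  have hlim := tendsto_measure_iInter_atTop hm hanti ⟨0, measure_ne_top _ _⟩
  rw [hzero] at hlim
  obtain ⟨N, hN⟩ := (hlim.eventually (gt_mem_nhds hε)).exists
  exact ⟨N, hN.le⟩

/-- Classical Banach Principle, implication (II) ⇒ (III): if the maximal function of a
sequence of continuous linear maps from a Banach space into L⁰ of a probability space is
a.e. finite at every point, then the maximal operator is continuous at 0, i.e. whenever
`x k → 0` in norm, the maximal functions `â(x k) = supₙ |aₙ(x k)|` tend to `0` in measure. -/
theorem banach_principle_II_implies_III
    {Ω : Type*} [MeasurableSpace Ω] (μ : Measure Ω) [IsProbabilityMeasure μ]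
    {X : Type*} [NormedAddCommGroup X] [NormedSpace ℂ X] [CompleteSpace X]
    (a : ℕ → X →ₗ[ℂ] Ω → ℂ)
    (hmeas : ∀ n x, Measurable (a n x))
    (hcont : ∀ n (x : X) (u : ℕ → X), Tendsto u atTop (𝓝 x) →
      TendstoInMeasure μ (fun k => a n (u k)) atTop (a n x))
    (hsup : ∀ x : X, ∀ᵐ ω ∂μ, (⨆ n, (‖a n x ω‖₊ : ℝ≥0∞)) < ⊤) :
    ∀ u : ℕ → X, Tendsto u atTop (𝓝 0) →
      ∀ δ : ℝ≥0∞, 0 < δ →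
        Tendsto (fun k => μ {ω | δ ≤ ⨆ n, (‖a n (u k) ω‖₊ : ℝ≥0∞)}) atTop (𝓝 0) := by
  intro u hu δ hδ
  rw [ENNReal.tendsto_nhds_zero]
  intro ε hε
  have hε2 : 0 < ε / 2 := ENNReal.half_pos hε.ne'
  obtain ⟨d, hd, hdδ⟩ : ∃ d : ℝ, 0 < d ∧ ENNReal.ofReal d < δ := by
    obtain ⟨d, hd, hdδ⟩ := ENNReal.lt_iff_exists_nnreal_btwn.1 hδ
    exact ⟨d, by exact_mod_cast hd, by simpa using hdδ⟩
  obtain ⟨N, x, hx⟩ := nonempty_interior_of_iUnion_of_closed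
    (fun N : ℕ => isClosed_setOf_measure_exists_lt_norm_le μ (fun n => a n) hcont N (ε / 2))
    (Set.eq_univ_of_forall fun x => Set.mem_iUnion.2
      (exists_nat_measure_exists_lt_norm_le μ (fun n => a n x) (fun n => hmeas n x)
        (hsup x) hε2))
  have hx0 := interior_subset hx
  set c : ℝ := (2 * N + 1) / d with hc
  have hcd : c * d = 2 * N + 1 := div_mul_cancel₀ _ hd.ne'
  have hc0 : 0 < c := by positivity
  have hlim : Tendsto (fun k => x + (c : ℂ) • u k) atTop (𝓝 x) := by
    simpa using (tendsto_const_nhds (x := x)).add (hu.const_smul (c : ℂ))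
  filter_upwards [hlim.eventually (mem_interior_iff_mem_nhds.1 hx)] with k hk
  calc μ {ω | δ ≤ ⨆ n, (‖a n (u k) ω‖₊ : ℝ≥0∞)}
      ≤ μ ({ω | ∃ n, (N : ℝ) < ‖a n (x + (c : ℂ) • u k) ω‖} ∪
          {ω | ∃ n, (N : ℝ) < ‖a n x ω‖}) := by
        refine measure_mono fun ω hω => ?_
        obtain ⟨n, hn⟩ := lt_iSup_iff.1 (hdδ.trans_le hω)
        have hn' : d < ‖a n (u k) ω‖ := by
          rw [← enorm_eq_nnnorm, ← ofReal_norm] at hn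
          exact (ENNReal.ofReal_lt_ofReal_iff_of_nonneg hd.le).1 hn
        by_contra hnot
        simp only [Set.mem_union, Set.mem_ofPred_eq, not_or, not_exists, not_lt] at hnot
        have h1 := hnot.1 n
        have h2 := hnot.2 n
        have h3 : c * ‖a n (u k) ω‖ ≤ ‖a n (x + (c : ℂ) • u k) ω‖ + ‖a n x ω‖ := by
          have := norm_sub_le (a n (x + (c : ℂ) • u k) ω) (a n x ω)
          simpa [abs_of_pos hc0] using this
        have h4 := mul_lt_mul_of_pos_left hn' hc0
        linarith
    _ ≤ ε / 2 + ε / 2 := (measure_union_le _ _).trans (add_le_add hk hx0)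
    _ = ε := ENNReal.add_halves ε
end

section
/- Let (Ω, Σ, μ) be a probability space, let (X, +) be a commutative semigroup, and let a_n : X → L⁰(Ω, μ) be a sequence of additive maps (a_n(x + y) = a_n(x) + a_n(y)). Suppose x̄ ∈ X is such that for every ε > 0 there exist a sequence (x_k) ⊂ X and a measurable set E ⊂ Ω with μ(Ω \ E) < ε such that: (i) for every k, the sequence (a_n(x̄ + x_k))_n converges almost uniformly; (ii) sup_n ‖a_n(x_k)·1_E‖_∞ → 0 as k → ∞ (in particular these suprema are finite). Then the sequence (a_n(x̄))_n converges almost uniformly. -/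
open MeasureTheory Filter Topology
open scoped ENNReal

/-- A sequence of (complex-valued) measurable functions converges almost uniformly:
for every `ε > 0` there is a measurable set `E` with `μ(Eᶜ) < ε` on which the sequence
converges uniformly (to some limit function `g`). -/
def ConvergesAU {Ω : Type*} [MeasurableSpace Ω] (μ : Measure Ω) (f : ℕ → Ω → ℂ) : Prop :=
  ∃ g : Ω → ℂ, ∀ ε : ℝ, 0 < ε → ∃ E : Set Ω, MeasurableSet E ∧
    μ Eᶜ < ENNReal.ofReal ε ∧ TendstoUniformlyOn f g atTop E

/-- A property that holds almost everywhere on sets with arbitrarily small complement holds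
almost everywhere. -/
theorem ae_of_forall_exists_compl_lt {Ω : Type*} [MeasurableSpace Ω] {μ : Measure Ω}
    {p : Ω → Prop}
    (h : ∀ ε : ℝ, 0 < ε → ∃ E : Set Ω, μ Eᶜ < ENNReal.ofReal ε ∧ ∀ᵐ ω ∂μ, ω ∈ E → p ω) :
    ∀ᵐ ω ∂μ, p ω := by
  rw [ae_iff]
  refine le_antisymm (ENNReal.le_of_forall_pos_le_add fun ε hε _ => ?_) zero_le
  obtain ⟨E, hE, hp⟩ := h ε (by exact_mod_cast hε)
  rw [ENNReal.ofReal_coe_nnreal] at hE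
  have hsub : {ω | ¬ p ω} ≤ᵐ[μ] Eᶜ := by
    filter_upwards [hp] with ω hω hn hmem using hn (hω hmem)
  simpa using (measure_mono_ae hsub).trans hE.le

/-- An almost uniformly convergent sequence is almost everywhere Cauchy. -/
theorem ConvergesAU.ae_cauchySeq {Ω : Type*} [MeasurableSpace Ω] {μ : Measure Ω}
    {f : ℕ → Ω → ℂ} (hf : ConvergesAU μ f) : ∀ᵐ ω ∂μ, CauchySeq fun n => f n ω := by
  obtain ⟨g, hg⟩ := hf
  refine ae_of_forall_exists_compl_lt fun ε hε => ?_
  obtain ⟨E, -, hE, hu⟩ := hg ε hε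
  exact ⟨E, hE, ae_of_all _ fun ω hω => (hu.tendsto_at hω).cauchySeq⟩

/-- A sequence that is uniformly approximated by Cauchy sequences is Cauchy. -/
theorem cauchySeq_of_forall_exists_dist_le {E : Type*} [PseudoMetricSpace E] {u : ℕ → E}
    (h : ∀ δ : ℝ, 0 < δ → ∃ v : ℕ → E, CauchySeq v ∧ ∀ n, dist (u n) (v n) ≤ δ) :
    CauchySeq u := by
  rw [Metric.cauchySeq_iff']
  intro δ hδ
  obtain ⟨v, hv, huv⟩ := h (δ / 4) (by positivity)
  obtain ⟨N, hN⟩ := Metric.cauchySeq_iff'.1 hv (δ / 4) (by positivity)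
  refine ⟨N, fun n hn => ?_⟩
  have h1 := dist_triangle4 (u n) (v n) (v N) (u N)
  have h2 := huv n
  have h3 := huv N
  have h4 := hN n hn
  rw [dist_comm] at h3
  linarith

/-- Commutative case of the paper's Lemma 1: let `aₙ` be additive maps from a
commutative semigroup `X` into L⁰ of a probability space. If `x̄ ∈ X` is such that for
every `ε > 0` there are a sequence `(x k) ⊆ X` and a measurable set `E` with
`μ(Eᶜ) < ε` such that (i) for every `k` the sequence `(aₙ(x̄ + x k))ₙ` converges almost
uniformly, and (ii) `supₙ ‖aₙ(x k)·1_E‖_∞ → 0` as `k → ∞`, then `(aₙ(x̄))ₙ` converges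
almost uniformly. -/
theorem lemma1_commutative_case
    {Ω : Type*} [MeasurableSpace Ω] (μ : Measure Ω) [IsProbabilityMeasure μ]
    {X : Type*} [AddCommSemigroup X]
    (a : ℕ → X → Ω → ℂ)
    (hmeas : ∀ n x, Measurable (a n x))
    (hadd : ∀ n x y, a n (x + y) =ᵐ[μ] a n x + a n y)
    (xbar : X)
    (h : ∀ ε : ℝ, 0 < ε → ∃ (x : ℕ → X) (E : Set Ω), MeasurableSet E ∧
      μ Eᶜ < ENNReal.ofReal ε ∧
      (∀ k, ConvergesAU μ (fun n => a n (xbar + x k))) ∧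
      Tendsto (fun k => ⨆ n, eLpNorm (E.indicator (a n (x k))) ⊤ μ) atTop (𝓝 0)) :
    ConvergesAU μ (fun n => a n xbar) := by
  have hcauchy : ∀ᵐ ω ∂μ, CauchySeq fun n => a n xbar ω := by
    refine ae_of_forall_exists_compl_lt fun ε hε => ?_
    obtain ⟨x, E, -, hE, hconv, hlim⟩ := h ε hε
    refine ⟨E, hE, ?_⟩
    have hc : ∀ᵐ ω ∂μ, ∀ k, CauchySeq fun n => a n (xbar + x k) ω :=
      ae_all_iff.2 fun k => (hconv k).ae_cauchySeq
    have ha : ∀ᵐ ω ∂μ, ∀ k n, a n (xbar + x k) ω = (a n xbar + a n (x k)) ω :=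
      ae_all_iff.2 fun k => ae_all_iff.2 fun n => hadd n xbar (x k)
    have hb : ∀ᵐ ω ∂μ, ∀ k n,
        ‖E.indicator (a n (x k)) ω‖ₑ ≤ eLpNorm (E.indicator (a n (x k))) ⊤ μ :=
      ae_all_iff.2 fun k => ae_all_iff.2 fun n => by
        rw [eLpNorm_exponent_top]
        exact enorm_ae_le_eLpNormEssSup _ μ
    filter_upwards [hc, ha, hb] with ω hc ha hb hω
    refine cauchySeq_of_forall_exists_dist_le fun δ hδ => ?_
    obtain ⟨k, hk⟩ := (hlim.eventually_lt_const (ENNReal.ofReal_pos.2 hδ)).exists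
    refine ⟨_, hc k, fun n => ?_⟩
    have hn := (hb k n).trans ((le_iSup (fun n => eLpNorm (E.indicator (a n (x k))) ⊤ μ) n).trans
      hk.le)
    rw [Set.indicator_of_mem hω, ← ofReal_norm, ENNReal.ofReal_le_ofReal_iff hδ.le] at hn
    rw [ha k n, Pi.add_apply, dist_self_add_right]
    exact hn
  obtain ⟨g, hg, hlim⟩ := measurable_limit_of_tendsto_metrizable_ae
    (fun n => (hmeas n xbar).aemeasurable) (hcauchy.mono fun _ => cauchySeq_tendsto_of_complete)
  refine ⟨g, fun ε hε => ?_⟩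
  obtain ⟨t, ht, hμt, hu⟩ := tendstoUniformlyOn_of_ae_tendsto'
    (fun n => (hmeas n xbar).stronglyMeasurable) hg.stronglyMeasurable hlim (half_pos hε)
  refine ⟨tᶜ, ht.compl, ?_, hu⟩
  rw [compl_compl]
  exact hμt.trans_lt ((ENNReal.ofReal_lt_ofReal_iff hε).2 (half_lt_self hε))
end

section
/- Let (Ω, Σ, μ) be a probability space, let d > 0, and let a_n : L∞(Ω, μ; ℝ) → L⁰(Ω, μ; ℝ) be a sequence of additive maps that is uniformly equicontinuous at 0 on the ball B_d = {x ∈ L∞ : ‖x‖_∞ ≤ d}. Then for every s > 0, the sequence (a_n) is uniformly equicontinuous at 0 on the ball B_s = {x ∈ L∞ : ‖x‖_∞ ≤ s}. -/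
open MeasureTheory Filter Topology
open scoped ENNReal

/-- The sequence of maps `aₙ : L∞ → L⁰` is uniformly equicontinuous at `0` on the set
`E ⊆ L∞`: for every `ε, δ > 0` there are `γ, η > 0` such that for every `x ∈ E` with
`μ{|x| > γ} < η` there is a measurable set `F` with `μ(Fᶜ) < ε` and
`supₙ ‖aₙ(x)·1_F‖_∞ < δ`. -/
def UnifEquicontAtZeroOn {Ω : Type*} [MeasurableSpace Ω] (μ : Measure Ω)
    (a : ℕ → (Ω → ℝ) → Ω → ℝ) (E : Set (Ω → ℝ)) : Prop :=
  ∀ ε δ : ℝ, 0 < ε → 0 < δ → ∃ γ η : ℝ, 0 < γ ∧ 0 < η ∧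
    ∀ x ∈ E, μ {ω | γ < |x ω|} < ENNReal.ofReal η →
      ∃ F : Set Ω, MeasurableSet F ∧ μ Fᶜ < ENNReal.ofReal ε ∧
        (⨆ n, eLpNorm (F.indicator (a n x)) ⊤ μ) < ENNReal.ofReal δ

/-- The ball of radius `d` in real `L∞`. -/
def LinftyBall {Ω : Type*} [MeasurableSpace Ω] (μ : Measure Ω) (d : ℝ) :
    Set (Ω → ℝ) :=
  {x | Measurable x ∧ eLpNorm x ⊤ μ ≤ ENNReal.ofReal d}

/-- A map that is almost everywhere additive on `L∞` is almost everywhere homogeneous for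
positive natural multiples. -/
theorem ae_eq_natCast_succ_smul_of_additive {Ω : Type*} [MeasurableSpace Ω] {μ : Measure Ω}
    {b : (Ω → ℝ) → Ω → ℝ}
    (hb : ∀ x y, Measurable x → Measurable y → eLpNorm x ⊤ μ < ⊤ →
      eLpNorm y ⊤ μ < ⊤ → b (x + y) =ᵐ[μ] b x + b y)
    {y : Ω → ℝ} (hy : Measurable y) (hy_top : eLpNorm y ⊤ μ < ⊤) (k : ℕ) :
    b (((k + 1 : ℕ) : ℝ) • y) =ᵐ[μ] ((k + 1 : ℕ) : ℝ) • b y := by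
  induction k with
  | zero => simp
  | succ k ih =>
    have hsplit (z : Ω → ℝ) :
        ((k + 1 + 1 : ℕ) : ℝ) • z = ((k + 1 : ℕ) : ℝ) • z + z := by
      rw [Nat.cast_succ, add_smul, one_smul]
    have htop : eLpNorm (((k + 1 : ℕ) : ℝ) • y) ⊤ μ < ⊤ := by
      rw [eLpNorm_const_smul]
      exact ENNReal.mul_lt_top enorm_lt_top hy_top
    rw [hsplit, hsplit]
    exact (hb _ _ (hy.const_smul _) hy htop hy_top).trans (ih.add .rfl)

/-- Commutative case of the paper's Lemma 3: if a sequence of additive maps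
`aₙ : L∞ → L⁰` over a probability space is uniformly equicontinuous at `0` on the ball
of some radius `d > 0`, it is uniformly equicontinuous at `0` on the ball of every
radius `s > 0`. -/
theorem lemma3_commutative_case
    {Ω : Type*} [MeasurableSpace Ω] (μ : Measure Ω) [IsProbabilityMeasure μ]
    (a : ℕ → (Ω → ℝ) → Ω → ℝ)
    (hmeas : ∀ n x, Measurable x → eLpNorm x ⊤ μ < ⊤ → Measurable (a n x))
    (hwd : ∀ n x y, Measurable x → Measurable y → eLpNorm x ⊤ μ < ⊤ →
      eLpNorm y ⊤ μ < ⊤ → x =ᵐ[μ] y → a n x =ᵐ[μ] a n y)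
    (hadd : ∀ n x y, Measurable x → Measurable y → eLpNorm x ⊤ μ < ⊤ →
      eLpNorm y ⊤ μ < ⊤ → a n (x + y) =ᵐ[μ] a n x + a n y)
    (d : ℝ) (hd : 0 < d)
    (hequi : UnifEquicontAtZeroOn μ a (LinftyBall μ d)) :
    ∀ s : ℝ, 0 < s → UnifEquicontAtZeroOn μ a (LinftyBall μ s) := by
  intro s hs ε δ hε hδ
  obtain ⟨k, hk⟩ := exists_nat_gt (s / d)
  set c : ℝ := ((k + 1 : ℕ) : ℝ) with hc
  have hck : c = k + 1 := Nat.cast_succ k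
  have hc_one : 1 ≤ c := by rw [hck]; linarith [k.cast_nonneg (α := ℝ)]
  have hc_pos : 0 < c := by linarith
  have hsc : c⁻¹ * s ≤ d := by
    rw [inv_mul_le_iff₀ hc_pos]
    rw [div_lt_iff₀ hd] at hk
    nlinarith
  obtain ⟨γ, η, hγ, hη, h⟩ := hequi ε (c⁻¹ * δ) hε (by positivity)
  refine ⟨γ, η, hγ, hη, fun x hx hxμ => ?_⟩
  obtain ⟨hx_meas, hx_norm⟩ := hx
  have hy_norm : eLpNorm (c⁻¹ • x) ⊤ μ ≤ ENNReal.ofReal d := by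
    rw [eLpNorm_const_smul, Real.enorm_of_nonneg (by positivity)]
    calc ENNReal.ofReal c⁻¹ * eLpNorm x ⊤ μ
        ≤ ENNReal.ofReal c⁻¹ * ENNReal.ofReal s := by gcongr
      _ = ENNReal.ofReal (c⁻¹ * s) := (ENNReal.ofReal_mul (by positivity)).symm
      _ ≤ ENNReal.ofReal d := ENNReal.ofReal_le_ofReal hsc
  have hyμ : μ {ω | γ < |(c⁻¹ • x) ω|} < ENNReal.ofReal η := by
    refine (measure_mono fun ω hω => ?_).trans_lt hxμ
    have hle : |(c⁻¹ • x) ω| ≤ |x ω| := by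
      rw [Pi.smul_apply, smul_eq_mul, abs_mul, abs_of_pos (inv_pos.2 hc_pos)]
      exact mul_le_of_le_one_left (abs_nonneg _) (inv_le_one_of_one_le₀ hc_one)
    exact lt_of_lt_of_le hω hle
  obtain ⟨F, hF, hFμ, hsup⟩ := h _ ⟨hx_meas.const_smul _, hy_norm⟩ hyμ
  refine ⟨F, hF, hFμ, ?_⟩
  have hnorm (n : ℕ) : eLpNorm (F.indicator (a n x)) ⊤ μ =
      ENNReal.ofReal c * eLpNorm (F.indicator (a n (c⁻¹ • x))) ⊤ μ := by
    have hae : a n x =ᵐ[μ] c • a n (c⁻¹ • x) := by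
      have := ae_eq_natCast_succ_smul_of_additive (hadd n) (hx_meas.const_smul c⁻¹)
        (hy_norm.trans_lt ENNReal.ofReal_lt_top) k
      rwa [← hc, smul_inv_smul₀ hc_pos.ne'] at this
    have hind : F.indicator (c • a n (c⁻¹ • x)) = c • F.indicator (a n (c⁻¹ • x)) :=
      Set.indicator_const_smul F c _
    rw [eLpNorm_congr_ae hae.indicator, hind, eLpNorm_const_smul,
      Real.enorm_of_nonneg hc_pos.le]
  have hc_ofReal : ENNReal.ofReal c ≠ 0 := (ENNReal.ofReal_pos.2 hc_pos).ne'
  calc ⨆ n, eLpNorm (F.indicator (a n x)) ⊤ μ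
      = ENNReal.ofReal c * ⨆ n, eLpNorm (F.indicator (a n (c⁻¹ • x))) ⊤ μ := by
        simp_rw [hnorm, ENNReal.mul_iSup]
    _ < ENNReal.ofReal c * ENNReal.ofReal (c⁻¹ * δ) :=
        ENNReal.mul_lt_mul_right hc_ofReal ENNReal.ofReal_ne_top hsup
    _ = ENNReal.ofReal δ := by
        rw [← ENNReal.ofReal_mul hc_pos.le, mul_inv_cancel_left₀ hc_pos.ne']
end
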